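/- Upper bound for the minimal stabilizing function: Let γ be C², 2π-periodic, positive, with 3γ(θ) − γ(θ−π) ≥ 0 for all θ. Define A(θ) = (π²/8)(5·sup|γ''| + 5|γ'(θ)| + γ(θ)). Then for every α ≥ (1/(4γ(θ)))·[A(θ)² + 4γ(θ)A(θ) + 4γ'(θ)²], the inequality 4γ(θ)·P_α(φ,θ) ≥ Q(φ,θ)² holds for all φ ∈ ℝ, where P_α(φ,θ) = γ(θ) − γ'(θ)sin 2φ + α sin²φ and Q(φ,θ) = γ(θ−φ) + γ(θ)cos φ − γ'(θ)sin φ. Consequently the set {α ≥ 0 : 4γ(θ)P_α(φ,θ) ≥ Q(φ,θ)² for all φ} is nonempty, so its infimum k₀(θ) is well-defined and k₀(θ) ≤ (1/(4γ(θ)))·[A(θ)² + 4γ(θ)A(θ) + 4γ'(θ)²]. -/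

import Mathlib

noncomputable def Lmat (θ : ℝ) : Matrix (Fin 2) (Fin 2) ℝ :=
  !![-Real.sin (2 * θ), Real.cos (2 * θ); Real.cos (2 * θ), Real.sin (2 * θ)]

noncomputable def nvec (θ : ℝ) : Fin 2 → ℝ := ![-Real.sin θ, Real.cos θ]

noncomputable def tvec (θ : ℝ) : Fin 2 → ℝ := ![Real.cos θ, Real.sin θ]

noncomputable def Zhat (γ k : ℝ → ℝ) (θ : ℝ) : Matrix (Fin 2) (Fin 2) ℝ :=
  γ θ • (1 : Matrix (Fin 2) (Fin 2) ℝ) + deriv γ θ • Lmat θ +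
    k θ • Matrix.vecMulVec (nvec θ) (nvec θ)

noncomputable def Pfun (γ : ℝ → ℝ) (α φ θ : ℝ) : ℝ :=
  γ θ - deriv γ θ * Real.sin (2 * φ) + α * Real.sin φ ^ 2

noncomputable def Qfun (γ : ℝ → ℝ) (φ θ : ℝ) : ℝ :=
  γ (θ - φ) + γ θ * Real.cos φ - deriv γ θ * Real.sin φ

noncomputable def Afun (γ : ℝ → ℝ) (θ : ℝ) : ℝ :=
  Real.pi ^ 2 / 8 *
    (5 * (⨆ x, |deriv (deriv γ) x|) + 5 * |deriv γ θ| + γ θ)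


lemma aux_core (g p A α s c Q : ℝ) (hg : 0 < g) (hsc : s ^ 2 + c ^ 2 = 1)
    (hα : α ≥ 1 / (4 * g) * (A ^ 2 + 4 * g * A + 4 * p ^ 2))
    (h1 : Q ≤ 2 * g - 2 * p * s * c + A * s ^ 2)
    (h2 : -Q ≤ 2 * g - 2 * p * s * c + A * s ^ 2) :
    4 * g * (g - p * (2 * s * c) + α * s ^ 2) ≥ Q ^ 2 := by
  have hα' : A ^ 2 + 4 * g * A + 4 * p ^ 2 ≤ 4 * g * α := by
    have := mul_le_mul_of_nonneg_left hα (by positivity : 0 ≤ 4 * g)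
    rw [← mul_assoc, mul_one_div_cancel (by positivity), one_mul] at this
    exact this
  have hQ : Q ^ 2 ≤ (2 * g - 2 * p * s * c + A * s ^ 2) ^ 2 := by
    apply sq_le_sq'
    · linarith
    · exact h1
  have h3 := mul_le_mul_of_nonneg_right hα' (sq_nonneg s)
  have h4 : 0 ≤ s ^ 2 * (2 * p * s + A * c) ^ 2 := by positivity
  have hc : c ^ 2 = 1 - s ^ 2 := by linarith
  have h5 : s ^ 2 * (2 * p * s + A * c) ^ 2 + (2 * g - 2 * p * s * c + A * s ^ 2) ^ 2
      = 4 * g ^ 2 - 8 * g * p * s * c + (A ^ 2 + 4 * g * A + 4 * p ^ 2) * s ^ 2 := by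
    linear_combination (A ^ 2 * s ^ 2 + 4 * p ^ 2 * s ^ 2) * hc
  nlinarith

lemma aux_trig (x : ℝ) (h1 : -(Real.pi / 2) ≤ x) (h2 : x ≤ Real.pi / 2) :
    x ^ 2 ≤ 2 * (Real.pi ^ 2 / 8) * Real.sin x ^ 2 ∧
    |x - Real.sin x| ≤ Real.pi ^ 2 / 8 * Real.sin x ^ 2 := by
  wlog hx : 0 ≤ x generalizing x
  · have := this (-x) (by linarith) (by linarith) (by linarith)
    rw [Real.sin_neg, neg_sq, neg_sq, ← abs_neg] at this
    rwa [show -(-x - -Real.sin x) = x - Real.sin x by ring] at this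
  have hp := Real.pi_pos
  have hp2 : Real.pi < 3.15 := Real.pi_lt_d2
  have hj := Real.mul_le_sin hx h2
  have hj' : x ≤ Real.pi / 2 * Real.sin x := by
    have := mul_le_mul_of_nonneg_left hj (by positivity : 0 ≤ Real.pi / 2)
    rwa [← mul_assoc, show Real.pi / 2 * (2 / Real.pi) = 1 by field_simp, one_mul] at this
  have hsq : x ^ 2 ≤ 2 * (Real.pi ^ 2 / 8) * Real.sin x ^ 2 := by
    have := pow_le_pow_left₀ hx hj' 2
    nlinarith
  refine ⟨hsq, ?_⟩
  have h3 := Real.sin_ge_sub_cube hx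
  have h4 := Real.sin_le hx
  rw [abs_of_nonneg (by linarith)]
  have : x ^ 3 ≤ 2 * x ^ 2 := by nlinarith [sq_nonneg x]
  nlinarith [sq_nonneg x]

lemma aux_alg1 (K s c x p : ℝ) (hK : 6 / 5 ≤ K) (hsc : s ^ 2 + c ^ 2 = 1) (hc : 0 ≤ c)
    (hxs : |x - s| ≤ K * s ^ 2) :
    p * (s - x) ≤ |p| * (K * s ^ 2) ∧ 2 * p * s * (c - 1) ≤ |p| * (2 * K * s ^ 2) := by
  constructor
  · calc p * (s - x) ≤ |p * (s - x)| := le_abs_self _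
      _ = |p| * |x - s| := by rw [abs_mul, abs_sub_comm]
      _ ≤ _ := by gcongr
  · have hc1 : c ≤ 1 := by nlinarith
    have hs1 : |s| ≤ 1 := by rw [abs_le_one_iff_mul_self_le_one]; nlinarith
    have h1 : 1 - c ≤ s ^ 2 := by nlinarith
    calc 2 * p * s * (c - 1) ≤ |2 * p * s * (c - 1)| := le_abs_self _
      _ = |p| * (2 * (|s| * (1 - c))) := by
        rw [abs_mul, abs_mul, abs_mul, abs_of_nonpos (by linarith : c - 1 ≤ 0)]
        norm_num; ring
      _ ≤ |p| * (2 * K * s ^ 2) := by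
        refine mul_le_mul_of_nonneg_left ?_ (abs_nonneg p)
        nlinarith [mul_le_mul_of_nonneg_right hs1 (by linarith : 0 ≤ 1 - c), sq_nonneg s]

lemma aux_tangent (f : ℝ → ℝ) (hf : ContDiff ℝ 2 f) (h2 : ∀ x, 0 ≤ deriv (deriv f) x)
    (x y : ℝ) : f x + deriv f x * (y - x) ≤ f y := by
  have hd : Differentiable ℝ f := hf.differentiable (by norm_num)
  have hd' : ContDiff ℝ 1 (deriv f) := by
    have : ContDiff ℝ (1 + 1) f := by simpa [one_add_one_eq_two] using hf
    exact (contDiff_succ_iff_deriv.1 this).2.2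
  have hm : Monotone (deriv f) := monotone_of_deriv_nonneg (hd'.differentiable (by norm_num)) h2
  rcases lt_trichotomy x y with h | h | h
  · obtain ⟨c, hc, he⟩ := exists_deriv_eq_slope f h hd.continuous.continuousOn hd.differentiableOn
    have := hm hc.1.le
    rw [he, le_div_iff₀ (by linarith)] at this
    linarith
  · subst h; simp
  · obtain ⟨c, hc, he⟩ := exists_deriv_eq_slope f h hd.continuous.continuousOn hd.differentiableOn
    have := hm hc.2.le
    rw [he, div_le_iff₀ (by linarith)] at this
    linarith

lemma aux_taylor (f : ℝ → ℝ) (hf : ContDiff ℝ 2 f) (M : ℝ) (h2 : ∀ x, -M ≤ deriv (deriv f) x)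
    (x t : ℝ) : f x - deriv f x * t - M * t ^ 2 / 2 ≤ f (x - t) := by
  have hd : Differentiable ℝ f := hf.differentiable (by norm_num)
  have hd' : ContDiff ℝ 1 (deriv f) := by
    have : ContDiff ℝ (1 + 1) f := by simpa [one_add_one_eq_two] using hf
    exact (contDiff_succ_iff_deriv.1 this).2.2
  have e1 : deriv (fun y => f y + M * y ^ 2 / 2) = fun y => deriv f y + M * y := by
    funext y
    have hh := (hd y).hasDerivAt.add (((hasDerivAt_pow 2 y).const_mul M).div_const 2)
    refine (hh.congr_deriv ?_).deriv
    norm_num; ring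
  have e2 : ∀ y, deriv (deriv (fun y => f y + M * y ^ 2 / 2)) y = deriv (deriv f) y + M := by
    intro y
    rw [e1]
    have hh := ((hd'.differentiable (by norm_num)) y).hasDerivAt.add ((hasDerivAt_id y).const_mul M)
    refine (hh.congr_deriv ?_).deriv
    ring
  have := aux_tangent (fun y => f y + M * y ^ 2 / 2) (by fun_prop)
    (fun y => by rw [e2]; linarith [h2 y]) x (x - t)
  rw [e1] at this
  simp only at this
  nlinarith

lemma aux_bdd (γ : ℝ → ℝ) (hγ : ContDiff ℝ 2 γ)
    (hper : ∀ x, γ (x + 2 * Real.pi) = γ x) (x : ℝ) :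
    |deriv (deriv γ) x| ≤ ⨆ x, |deriv (deriv γ) x| := by
  have hd' : ContDiff ℝ 1 (deriv γ) := by
    have : ContDiff ℝ (1 + 1) γ := by simpa [one_add_one_eq_two] using hγ
    exact (contDiff_succ_iff_deriv.1 this).2.2
  have hc : Continuous (deriv (deriv γ)) := hd'.continuous_deriv (by norm_num)
  have p1 : ∀ x, deriv γ (x + 2 * Real.pi) = deriv γ x := by
    intro x
    rw [← deriv_comp_add_const]
    congr 1
    funext y; exact hper y
  have p2 : ∀ x, deriv (deriv γ) (x + 2 * Real.pi) = deriv (deriv γ) x := by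
    intro x
    rw [← deriv_comp_add_const]
    congr 1
    funext y; exact p1 y
  have hP : Function.Periodic (fun x => |deriv (deriv γ) x|) (2 * Real.pi) := by
    intro x; simp only [p2]
  have hcpt := hP.compact_of_continuous (by positivity) hc.abs
  exact le_ciSup hcpt.bddAbove x

lemma aux_main (γ : ℝ → ℝ) (hγ : ContDiff ℝ 2 γ)
    (hper : ∀ x, γ (x + 2 * Real.pi) = γ x) (hpos : ∀ x, 0 < γ x)
    (hstab : ∀ θ, 0 ≤ 3 * γ θ - γ (θ - Real.pi)) (θ α : ℝ)
    (hα : α ≥ 1 / (4 * γ θ) *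
        (Afun γ θ ^ 2 + 4 * γ θ * Afun γ θ + 4 * deriv γ θ ^ 2)) (φ : ℝ) :
    4 * γ θ * Pfun γ α φ θ ≥ Qfun γ φ θ ^ 2 := by
  have hb := aux_bdd γ hγ hper
  have hA : Afun γ θ = Real.pi ^ 2 / 8 *
    (5 * (⨆ x, |deriv (deriv γ) x|) + 5 * |deriv γ θ| + γ θ) := rfl
  set A := Afun γ θ
  set M := ⨆ x, |deriv (deriv γ) x|
  set K := Real.pi ^ 2 / 8 with hKd
  have hK : 6 / 5 ≤ K := by
    have := Real.pi_gt_d2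
    rw [hKd]; nlinarith
  have hM : 0 ≤ M := (abs_nonneg _).trans (hb 0)
  have hlow := aux_taylor γ hγ M (fun x => neg_le_of_abs_le (hb x)) θ
  have hup : ∀ t, γ (θ - t) ≤ γ θ - deriv γ θ * t + M * t ^ 2 / 2 := by
    intro t
    have e : deriv (-γ) = -deriv γ := by funext y; exact deriv.neg
    have e2 : deriv (deriv (-γ)) = -deriv (deriv γ) := by rw [e]; funext y; exact deriv.neg
    have := aux_taylor (-γ) hγ.neg M (fun x => by
      rw [e2]; exact neg_le_neg (le_of_abs_le (hb x))) θ t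
    rw [e] at this
    simp only [Pi.neg_apply] at this
    linarith
  have hg := hpos θ
  -- positivity forces a bound on the derivative
  have hps : ∀ s, |deriv γ θ * s| ≤ γ θ + M * s ^ 2 / 2 := by
    intro s
    rw [abs_le]
    have a := hup s
    have b := hup (-s)
    have a' := hpos (θ - s)
    have b' := hpos (θ - -s)
    constructor <;> nlinarith
  have hPer : Function.Periodic (fun φ => 4 * γ θ * Pfun γ α φ θ - Qfun γ φ θ ^ 2)
      (2 * Real.pi) := by
    intro x
    have h1 : γ (θ - (x + 2 * Real.pi)) = γ (θ - x) := by
      rw [← hper]; congr 1; ring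
    have h2 : Real.sin (2 * (x + 2 * Real.pi)) = Real.sin (2 * x) := by
      rw [Real.sin_two_mul, Real.sin_two_mul, Real.sin_add_two_pi, Real.cos_add_two_pi]
    simp only [Pfun, Qfun, h1, h2, Real.sin_add_two_pi, Real.cos_add_two_pi]
  obtain ⟨y, hy, hxy⟩ := hPer.exists_mem_Ico Real.two_pi_pos φ (-(Real.pi / 2))
  suffices 4 * γ θ * Pfun γ α y θ ≥ Qfun γ y θ ^ 2 by linarith
  clear hxy hPer
  unfold Pfun Qfun
  rw [Real.sin_two_mul]
  have hpa := abs_nonneg (deriv γ θ)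
  apply aux_core _ _ A _ _ _ _ hg (Real.sin_sq_add_cos_sq y) hα
  all_goals
    rw [hA]
    rcases le_total y (Real.pi / 2) with hy2 | hy2
  · -- upper bound near 0
    obtain ⟨t1, t2⟩ := aux_trig y hy.1 hy2
    rw [← hKd] at t1 t2
    have hc := Real.cos_nonneg_of_mem_Icc ⟨hy.1, hy2⟩
    have hsc := Real.sin_sq_add_cos_sq y
    have hu := hup y
    obtain ⟨q1, q2⟩ := aux_alg1 K _ _ y (deriv γ θ) hK hsc hc t2
    have hc1 := Real.cos_le_one y
    have m1 := mul_le_mul_of_nonneg_left t1 hM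
    have n1 : 0 ≤ M * (K * Real.sin y ^ 2) := by positivity
    have n2 : 0 ≤ |deriv γ θ| * (K * Real.sin y ^ 2) := by positivity
    have n3 : 0 ≤ γ θ * (K * Real.sin y ^ 2) := by positivity
    have n4 : 0 ≤ γ θ * (1 - Real.cos y) := mul_nonneg hg.le (by linarith)
    linarith
  · -- upper bound near π
    obtain ⟨x, rfl⟩ : ∃ x, y = x + Real.pi := ⟨y - Real.pi, by ring⟩
    have hx1 : -(Real.pi / 2) ≤ x := by linarith
    have hx2 : x ≤ Real.pi / 2 := by linarith [hy.2]
    obtain ⟨t1, t2⟩ := aux_trig x hx1 hx2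
    rw [← hKd] at t1 t2
    have hc := Real.cos_nonneg_of_mem_Icc ⟨hx1, hx2⟩
    have hsc := Real.sin_sq_add_cos_sq x
    have hu := hup x
    obtain ⟨q1, q2⟩ := aux_alg1 K _ _ x (deriv γ θ) hK hsc hc t2
    have hst := hstab (θ - x)
    rw [show θ - x - Real.pi = θ - (x + Real.pi) by ring] at hst
    rw [Real.sin_add_pi, Real.cos_add_pi]
    have hc1 := Real.cos_le_one x
    have m1 := mul_le_mul_of_nonneg_left t1 hM
    have n1 : 0 ≤ M * (K * Real.sin x ^ 2) := by positivity
    have n2 : 0 ≤ |deriv γ θ| * (K * Real.sin x ^ 2) := by positivity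
    have n5 : 1 - Real.cos x ≤ K * Real.sin x ^ 2 := by nlinarith
    have n4 := mul_le_mul_of_nonneg_left n5 hg.le
    linarith
  · -- lower bound near 0
    have hc := Real.cos_nonneg_of_mem_Icc ⟨hy.1, hy2⟩
    have hc1 := Real.cos_le_one y
    have hu := hpos (θ - y)
    have h1 := (abs_le.1 (hps (Real.sin y))).2
    have h2 := mul_le_mul_of_nonneg_right h1 (by linarith : 0 ≤ 1 + 2 * Real.cos y)
    have n0 : 0 ≤ M * Real.sin y ^ 2 := by positivity
    have n1 := mul_le_mul_of_nonneg_left hK n0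
    have n2 : 0 ≤ |deriv γ θ| * (K * Real.sin y ^ 2) := by positivity
    have n3 : 0 ≤ γ θ * (K * Real.sin y ^ 2) := by positivity
    have n4 : 0 ≤ γ θ * (1 - Real.cos y) := mul_nonneg hg.le (by linarith)
    have n5 : 0 ≤ M * Real.sin y ^ 2 * (1 - Real.cos y) := mul_nonneg n0 (by linarith)
    linarith
  · -- lower bound near π
    obtain ⟨x, rfl⟩ : ∃ x, y = x + Real.pi := ⟨y - Real.pi, by ring⟩
    have hx1 : -(Real.pi / 2) ≤ x := by linarith
    have hx2 : x ≤ Real.pi / 2 := by linarith [hy.2]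
    have hc := Real.cos_nonneg_of_mem_Icc ⟨hx1, hx2⟩
    have hc1 := Real.cos_le_one x
    have hu := hpos (θ - (x + Real.pi))
    rw [Real.sin_add_pi, Real.cos_add_pi]
    have h1 := hps (Real.sin x)
    have h3 : -(deriv γ θ * Real.sin x * (1 - 2 * Real.cos x)) ≤
        |deriv γ θ * Real.sin x| := by
      calc _ ≤ |deriv γ θ * Real.sin x * (1 - 2 * Real.cos x)| := neg_le_abs _
        _ = |deriv γ θ * Real.sin x| * |1 - 2 * Real.cos x| := abs_mul _ _
        _ ≤ |deriv γ θ * Real.sin x| * 1 := by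
          gcongr
          rw [abs_le]; constructor <;> linarith
        _ = _ := mul_one _
    have n0 : 0 ≤ M * Real.sin x ^ 2 := by positivity
    have n1 := mul_le_mul_of_nonneg_left hK n0
    have n2 : 0 ≤ |deriv γ θ| * (K * Real.sin x ^ 2) := by positivity
    have n3 : 0 ≤ γ θ * (K * Real.sin x ^ 2) := by positivity
    have n4 : 0 ≤ γ θ * (1 - Real.cos x) := mul_nonneg hg.le (by linarith)
    linarith

theorem stmt13 (γ : ℝ → ℝ) (hγ : ContDiff ℝ 2 γ)
    (hper : ∀ x, γ (x + 2 * Real.pi) = γ x) (hpos : ∀ x, 0 < γ x)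
    (hstab : ∀ θ, 0 ≤ 3 * γ θ - γ (θ - Real.pi)) (θ : ℝ) :
    (∀ α : ℝ, α ≥ 1 / (4 * γ θ) *
        (Afun γ θ ^ 2 + 4 * γ θ * Afun γ θ + 4 * deriv γ θ ^ 2) →
      ∀ φ : ℝ, 4 * γ θ * Pfun γ α φ θ ≥ Qfun γ φ θ ^ 2) ∧
    {α : ℝ | 0 ≤ α ∧ ∀ φ : ℝ, 4 * γ θ * Pfun γ α φ θ ≥ Qfun γ φ θ ^ 2}.Nonempty ∧
    sInf {α : ℝ | 0 ≤ α ∧ ∀ φ : ℝ, 4 * γ θ * Pfun γ α φ θ ≥ Qfun γ φ θ ^ 2} ≤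
      1 / (4 * γ θ) *
        (Afun γ θ ^ 2 + 4 * γ θ * Afun γ θ + 4 * deriv γ θ ^ 2) := by
  have h1 := aux_main γ hγ hper hpos hstab θ
  have hg := hpos θ
  have hM : 0 ≤ ⨆ x, |deriv (deriv γ) x| :=
    (abs_nonneg _).trans (aux_bdd γ hγ hper 0)
  have hA : 0 ≤ Afun γ θ := by
    unfold Afun
    positivity
  have hB : (1 / (4 * γ θ) *
        (Afun γ θ ^ 2 + 4 * γ θ * Afun γ θ + 4 * deriv γ θ ^ 2)) ∈
      {α : ℝ | 0 ≤ α ∧ ∀ φ : ℝ, 4 * γ θ * Pfun γ α φ θ ≥ Qfun γ φ θ ^ 2} :=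
    ⟨by positivity, h1 _ le_rfl⟩
  exact ⟨h1, ⟨_, hB⟩, csInf_le ⟨0, fun _ h => h.1⟩ hB⟩
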